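/- Let γ^1,…,γ^n: ℝ^k → ℝ^{m×m} be pseudo cross-variograms (with nonnegative entries). Let Σ be a symmetric positive definite d×d real matrix, and let Σ_1,…,Σ_n be symmetric positive semi-definite d×d real matrices. For i,j = 1,…,m and u ∈ ℝ^k define A_ij(u) = Σ + ∑_{ℓ=1}^n γ^ℓ_ij(u) Σ_ℓ (a symmetric positive definite, hence invertible, matrix). Then the matrix-valued function C: ℝ^d × ℝ^k → ℝ^{m×m} with entries C_ij(h,u) = det(A_ij(u))^{−1/2} · exp(−(1/2) hᵀ A_ij(u)^{−1} h), i,j = 1,…,m, is a positive definite matrix-valued function on ℝ^{d+k}. -/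

import Mathlib

open Matrix MeasureTheory Real Set
open scoped BigOperators

/-- A matrix-valued kernel `C : X × X → ℝ^{m×m}` is positive definite if it is symmetric
(`C_ij(x,y) = C_ji(y,x)`) and all quadratic forms `∑_p ∑_q a_pᵀ C(x_p, x_q) a_q` are
nonnegative. -/
def IsPosDefKernel {X : Type*} {m : ℕ} (C : X → X → Matrix (Fin m) (Fin m) ℝ) : Prop :=
  (∀ x y i j, C x y i j = C y x j i) ∧
  ∀ (n : ℕ) (x : Fin n → X) (a : Fin n → Fin m → ℝ),
    0 ≤ ∑ p, ∑ q, a p ⬝ᵥ (C (x p) (x q)).mulVec (a q)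

/-- A matrix-valued kernel `Γ : X × X → ℝ^{m×m}` is conditionally negative definite if it is
symmetric (`Γ_ij(x,y) = Γ_ji(y,x)`) and all quadratic forms `∑_p ∑_q a_pᵀ Γ(x_p, x_q) a_q`
with `1_mᵀ ∑_p a_p = 0` are nonpositive. -/
def IsCondNegDefKernel {X : Type*} {m : ℕ} (Γ : X → X → Matrix (Fin m) (Fin m) ℝ) : Prop :=
  (∀ x y i j, Γ x y i j = Γ y x j i) ∧
  ∀ (n : ℕ) (x : Fin n → X) (a : Fin n → Fin m → ℝ),
    (∑ p, ∑ i, a p i) = 0 →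
    ∑ p, ∑ q, a p ⬝ᵥ (Γ (x p) (x q)).mulVec (a q) ≤ 0

/-- A non-stationary pseudo cross-variogram: a conditionally negative definite matrix-valued
kernel vanishing on the diagonal of its diagonal components. -/
def IsNSPseudoCrossVariogram {X : Type*} {m : ℕ}
    (Γ : X → X → Matrix (Fin m) (Fin m) ℝ) : Prop :=
  IsCondNegDefKernel Γ ∧ ∀ x i, Γ x x i i = 0

/-- A matrix-valued function is positive definite if the associated translation-invariant
kernel `(x, y) ↦ C (x - y)` is a positive definite kernel. -/
def IsPosDefFun {V : Type*} [AddCommGroup V] {m : ℕ}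
    (C : V → Matrix (Fin m) (Fin m) ℝ) : Prop :=
  IsPosDefKernel (fun x y => C (x - y))

/-- A (stationary) pseudo cross-variogram: the kernel `(x,y) ↦ γ(x−y)` is conditionally
negative definite and `γ_ii(0) = 0` for all `i`. -/
def IsPseudoCrossVariogram {V : Type*} [AddCommGroup V] {m : ℕ}
    (γ : V → Matrix (Fin m) (Fin m) ℝ) : Prop :=
  IsCondNegDefKernel (fun x y => γ (x - y)) ∧ ∀ i, γ 0 i i = 0

/-- A real matrix with nonnegative quadratic form on vectors, stated with explicit double sums. -/
theorem Matrix.posSemidef_iff_sum_nonneg {ι : Type*} [Fintype ι] {M : Matrix ι ι ℝ} :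
    M.PosSemidef ↔ (∀ a b, M a b = M b a) ∧ ∀ c : ι → ℝ, 0 ≤ ∑ a, ∑ b, c a * M a b * c b := by
  simp [Matrix.posSemidef_iff_dotProduct_mulVec, Matrix.IsHermitian, ← Matrix.ext_iff,
    dotProduct, mulVec, Finset.mul_sum, mul_assoc]
  exact fun _ => ⟨fun h i j => (h j i), fun h i j => h j i⟩

/-- Entrywise powers of a positive semidefinite matrix are positive semidefinite. -/
theorem Matrix.PosSemidef.map_pow {ι : Type*} [Fintype ι] {K : Matrix ι ι ℝ}
    (hK : K.PosSemidef) (n : ℕ) : (K.map (· ^ n)).PosSemidef := by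
  induction n with
  | zero =>
    convert Matrix.posSemidef_vecMulVec_self_star (R := ℝ) (fun _ : ι => (1 : ℝ)) using 1
    ext a b
    simp [vecMulVec_apply]
  | succ n ih =>
    have e : K.map (· ^ (n + 1)) = K.map (· ^ n) ⊙ K := by
      ext a b
      simp [pow_succ]
    exact e ▸ ih.hadamard hK

/-- The entrywise exponential of a positive semidefinite matrix is positive semidefinite. -/
theorem Matrix.PosSemidef.map_exp {ι : Type*} [Fintype ι] {K : Matrix ι ι ℝ}
    (hK : K.PosSemidef) : (K.map Real.exp).PosSemidef := by
  rw [Matrix.posSemidef_iff_sum_nonneg]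
  refine ⟨fun a b => ?_, fun c => ?_⟩
  · simp [(Matrix.posSemidef_iff_sum_nonneg.1 hK).1 a b]
  · have hs : HasSum (fun n : ℕ => ∑ a, ∑ b, c a * (K a b ^ n / n.factorial) * c b)
        (∑ a, ∑ b, c a * Real.exp (K a b) * c b) := by
      refine hasSum_sum fun a _ => hasSum_sum fun b _ => ?_
      have h := NormedSpace.exp_series_hasSum_exp' (𝕂 := ℝ) (K a b)
      rw [← Real.exp_eq_exp_ℝ] at h
      simpa [div_eq_inv_mul] using (h.mul_left (c a)).mul_right (c b)
    refine hs.nonneg fun n => ?_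
    have h := (Matrix.posSemidef_iff_sum_nonneg.1 (hK.map_pow n)).2 c
    have e : ∑ a, ∑ b, c a * (K a b ^ n / n.factorial) * c b
        = (∑ a, ∑ b, c a * K.map (· ^ n) a b * c b) / n.factorial := by
      simp only [Finset.sum_div, Matrix.map_apply]
      refine Finset.sum_congr rfl fun a _ => Finset.sum_congr rfl fun b _ => ?_
      ring
    rw [e]
    positivity

/-- **Schoenberg's theorem** on a finite set: if `g` is symmetric and conditionally negative
definite, then the entrywise exponential of `-g` is positive semidefinite. -/
theorem Matrix.posSemidef_map_exp_neg {ι : Type*} [Fintype ι] {g : Matrix ι ι ℝ}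
    (hsymm : ∀ a b, g a b = g b a)
    (hg : ∀ c : ι → ℝ, ∑ a, c a = 0 → ∑ a, ∑ b, c a * g a b * c b ≤ 0) :
    (g.map fun t => Real.exp (-t)).PosSemidef := by
  classical
  rcases isEmpty_or_nonempty ι with hι | ⟨⟨o⟩⟩
  · exact Matrix.posSemidef_iff_sum_nonneg.2 ⟨fun a => isEmptyElim a, by simp⟩
  have hK : (Matrix.of fun a b => g a o + g o b - g a b - g o o).PosSemidef := by
    rw [Matrix.posSemidef_iff_sum_nonneg]
    refine ⟨fun a b => ?_, fun c => ?_⟩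
    · simp only [Matrix.of_apply]
      rw [hsymm a b, hsymm a o, hsymm o b]
      ring
    · set s := ∑ a, c a with hs
      have h := hg (c - Pi.single o s) (by simp [Finset.sum_sub_distrib, hs])
      have e1 : ∑ a, ∑ b, (c - Pi.single o s : ι → ℝ) a * g a b * (c - Pi.single o s : ι → ℝ) b
          = ∑ a, ∑ b, c a * g a b * c b - (∑ a, c a * g a o) * s
            - s * (∑ b, g o b * c b) + s * g o o * s := by
        simp only [Pi.sub_apply, sub_mul, mul_sub, Finset.sum_sub_distrib, Pi.single_apply,
          ite_mul, mul_ite, mul_zero, zero_mul, Finset.sum_ite_eq', Finset.mem_univ, if_true,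
          Finset.sum_ite_irrel, Finset.sum_const_zero, Finset.sum_mul, mul_assoc,
          ← Finset.mul_sum]
        ring
      have e2 : ∑ a, ∑ b, c a * (g a o + g o b - g a b - g o o) * c b
          = (∑ a, c a * g a o) * s + s * (∑ b, g o b * c b) - ∑ a, ∑ b, c a * g a b * c b
            - s * g o o * s := by
        rw [hs, Finset.sum_mul_sum, Finset.sum_mul_sum, Finset.sum_mul, Finset.sum_mul_sum]
        simp only [← Finset.sum_add_distrib, ← Finset.sum_sub_distrib]
        refine Finset.sum_congr rfl fun a _ => Finset.sum_congr rfl fun b _ => ?_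
        ring
      simp only [Matrix.of_apply]
      linarith
  have hE := Matrix.posSemidef_iff_sum_nonneg.1 hK.map_exp
  rw [Matrix.posSemidef_iff_sum_nonneg]
  refine ⟨fun a b => by simp [hsymm a b], fun c => ?_⟩
  have h := hE.2 fun a => c a * Real.exp (-g a o)
  have e : ∑ a, ∑ b, c a * (g.map fun t => Real.exp (-t)) a b * c b
      = Real.exp (g o o) * ∑ a, ∑ b, (c a * Real.exp (-g a o)) *
        ((Matrix.of fun a b => g a o + g o b - g a b - g o o).map Real.exp) a b *
          (c b * Real.exp (-g b o)) := by
    simp only [Finset.mul_sum]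
    refine Finset.sum_congr rfl fun a _ => Finset.sum_congr rfl fun b _ => ?_
    have : Real.exp (-g a b) = Real.exp (g o o) * Real.exp (-g a o) *
        Real.exp (g a o + g o b - g a b - g o o) * Real.exp (-g b o) := by
      rw [← Real.exp_add, ← Real.exp_add, ← Real.exp_add, hsymm b o]
      ring_nf
    simp only [Matrix.map_apply, Matrix.of_apply, this]
    ring
  rw [e]
  positivity

/-- The Fourier transform of the standard Gaussian on `Fin d → ℝ`. -/
theorem integral_exp_neg_half_dotProduct_mul_cos {d : ℕ} (w : Fin d → ℝ) :
    Integrable (fun v : Fin d → ℝ => Real.exp (-(1/2) * (v ⬝ᵥ v)) * Real.cos (v ⬝ᵥ w)) ∧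
    ∫ v : Fin d → ℝ, Real.exp (-(1/2) * (v ⬝ᵥ v)) * Real.cos (v ⬝ᵥ w)
      = (2 * π) ^ ((d : ℝ) / 2) * Real.exp (-(1/2) * (w ⬝ᵥ w)) := by
  have hb : 0 < (1/2 : ℂ).re := by norm_num
  have hI := GaussianFourier.integrable_cexp_neg_mul_sum_add hb fun i => (w i : ℂ) * Complex.I
  have hV := GaussianFourier.integral_cexp_neg_mul_sum_add hb fun i => (w i : ℂ) * Complex.I
  have hre : ∀ v : Fin d → ℝ,
      (Complex.exp (-(1/2) * ∑ i, (v i : ℂ) ^ 2 + ∑ i, (w i : ℂ) * Complex.I * v i)).re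
        = Real.exp (-(1/2) * (v ⬝ᵥ v)) * Real.cos (v ⬝ᵥ w) := by
    intro v
    have : (-(1/2) * ∑ i, (v i : ℂ) ^ 2 + ∑ i, (w i : ℂ) * Complex.I * v i)
        = ((-(1/2) * (v ⬝ᵥ v) : ℝ) : ℂ) + ((v ⬝ᵥ w : ℝ) : ℂ) * Complex.I := by
      simp only [dotProduct, Complex.ofReal_mul, Complex.ofReal_sum, Finset.sum_mul]
      push_cast
      congr 1
      · simp only [sq]
      · exact Finset.sum_congr rfl fun i _ => by ring
    rw [this, Complex.exp_re]
    simp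
  have hrhs : ((π : ℂ) / (1/2)) ^ (Fintype.card (Fin d) / 2 : ℂ)
        * Complex.exp ((∑ i, ((w i : ℂ) * Complex.I) ^ 2) / (4 * (1/2)))
      = (((2 * π) ^ ((d : ℝ) / 2) * Real.exp (-(1/2) * (w ⬝ᵥ w)) : ℝ) : ℂ) := by
    rw [Complex.ofReal_mul, Complex.ofReal_cpow (by positivity), Complex.ofReal_exp]
    congr 2
    · push_cast; ring
    · simp
    · simp only [mul_pow, Complex.I_sq, dotProduct]
      push_cast
      rw [← Finset.sum_mul]
      simp only [sq]
      ring
  rw [hrhs] at hV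
  refine ⟨by simpa only [RCLike.re_eq_complex_re, hre] using hI.re, ?_⟩
  have h := congrArg Complex.re hV
  rw [← RCLike.re_eq_complex_re, ← integral_re hI] at h
  simpa only [RCLike.re_eq_complex_re, hre, Complex.ofReal_re] using h

/-- The Fourier transform of a centred Gaussian on `ℝ^d` with positive definite precision
matrix `A`. -/
theorem Matrix.PosDef.integral_exp_neg_half_mul_cos {d : ℕ} {A : Matrix (Fin d) (Fin d) ℝ}
    (hA : A.PosDef) (h : Fin d → ℝ) :
    Integrable (fun v : Fin d → ℝ =>
      Real.exp (-(1/2) * (v ⬝ᵥ A.mulVec v)) * Real.cos (v ⬝ᵥ h)) ∧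
    ∫ v : Fin d → ℝ, Real.exp (-(1/2) * (v ⬝ᵥ A.mulVec v)) * Real.cos (v ⬝ᵥ h)
      = (2 * π) ^ ((d : ℝ) / 2) *
        (A.det ^ (-(1:ℝ)/2) * Real.exp (-(1/2) * (h ⬝ᵥ A⁻¹.mulVec h))) := by
  obtain ⟨B, hB⟩ : ∃ B : Matrix (Fin d) (Fin d) ℝ, A = Bᵀ * B := by
    open scoped MatrixOrder in
    obtain ⟨B, hB⟩ := CStarAlgebra.nonneg_iff_eq_star_mul_self.1 hA.posSemidef.nonneg
    exact ⟨B, by simpa [star_eq_conjTranspose] using hB⟩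
  have hdet : A.det = B.det ^ 2 := by rw [hB, det_mul, det_transpose, sq]
  have hB0 : B.det ≠ 0 := by
    intro h0
    have := hA.det_pos
    simp [hdet, h0] at this
  have hu : IsUnit B.det := isUnit_iff_ne_zero.2 hB0
  set w := (B⁻¹)ᵀ.mulVec h with hw
  have hq : ∀ v, v ⬝ᵥ A.mulVec v = B.mulVec v ⬝ᵥ B.mulVec v := by
    intro v
    rw [hB, ← mulVec_mulVec, dotProduct_mulVec, vecMul_transpose]
  have hl : ∀ v, v ⬝ᵥ h = B.mulVec v ⬝ᵥ w := by
    intro v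
    rw [hw, dotProduct_mulVec, vecMul_transpose, mulVec_mulVec, nonsing_inv_mul _ hu,
      one_mulVec]
  have hww : w ⬝ᵥ w = h ⬝ᵥ A⁻¹.mulVec h := by
    rw [hB, mul_inv_rev, ← transpose_nonsing_inv, ← mulVec_mulVec, dotProduct_mulVec h,
      ← mulVec_transpose]
  have hmap := Real.map_matrix_volume_pi_eq_smul_volume_pi hB0
  obtain ⟨hI, hV⟩ := integral_exp_neg_half_dotProduct_mul_cos w
  have hpow : A.det ^ (-(1:ℝ)/2) = |B.det⁻¹| := by
    rw [hdet, ← sq_abs, ← Real.rpow_natCast, ← Real.rpow_mul (abs_nonneg _), abs_inv,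
      ← Real.rpow_neg_one]
    norm_num
  have hme : MeasurableEmbedding (toLin' B) :=
    (toLin'OfInv (nonsing_inv_mul B hu) (mul_nonsing_inv B
      hu)).toContinuousLinearEquiv.toHomeomorph.measurableEmbedding
  simp only [hq, hl]
  set f : (Fin d → ℝ) → ℝ := fun v => Real.exp (-(1/2) * (v ⬝ᵥ v)) * Real.cos (v ⬝ᵥ w) with hf
  constructor
  · have : Integrable f (Measure.map (toLin' B) volume) := by
      rw [hmap]
      exact hI.smul_measure ENNReal.ofReal_ne_top
    exact hme.integrable_map_iff.1 this
  · have h1 := hme.integral_map (μ := volume) f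
    rw [hmap, integral_smul_measure, ENNReal.toReal_ofReal (abs_nonneg _), hV] at h1
    rw [hpow, ← hww]
    simp only [toLin'_apply, smul_eq_mul] at h1
    exact h1.symm.trans (by ring)

/-- Finite-index form of the extended Gaussian model: mixing centred Gaussians over conditionally
negative definite matrices yields nonnegative quadratic forms. -/
theorem sum_gaussian_mixture_nonneg {ι : Type*} [Fintype ι] {d n : ℕ}
    (g : Fin n → Matrix ι ι ℝ) (hsymm : ∀ ℓ a b, g ℓ a b = g ℓ b a)
    (hg : ∀ ℓ (c : ι → ℝ), ∑ a, c a = 0 → ∑ a, ∑ b, c a * g ℓ a b * c b ≤ 0)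
    (hnn : ∀ ℓ a b, 0 ≤ g ℓ a b)
    {S0 : Matrix (Fin d) (Fin d) ℝ} (hS0 : S0.PosDef)
    {S : Fin n → Matrix (Fin d) (Fin d) ℝ} (hS : ∀ ℓ, (S ℓ).PosSemidef)
    {A : ι → ι → Matrix (Fin d) (Fin d) ℝ} (hA : ∀ a b, A a b = S0 + ∑ ℓ, g ℓ a b • S ℓ)
    (h : ι → Fin d → ℝ) (c : ι → ℝ) :
    0 ≤ ∑ a, ∑ b, c a * ((A a b).det ^ (-(1:ℝ)/2) *
      Real.exp (-(1/2) * ((h a - h b) ⬝ᵥ (A a b)⁻¹.mulVec (h a - h b)))) * c b := by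
  have hApos : ∀ a b, (A a b).PosDef := fun a b => by
    rw [hA]
    exact hS0.add_posSemidef (Matrix.posSemidef_sum _ fun ℓ _ => (hS ℓ).smul (hnn ℓ a b))
  have hF := fun a b => (hApos a b).integral_exp_neg_half_mul_cos (h a - h b)
  have hpi : 0 < (2 * π) ^ ((d : ℝ) / 2) := by positivity
  refine nonneg_of_mul_nonneg_right (a := (2 * π) ^ ((d : ℝ) / 2)) ?_ hpi
  have hint : (2 * π) ^ ((d : ℝ) / 2) * ∑ a, ∑ b, c a * ((A a b).det ^ (-(1:ℝ)/2) *
      Real.exp (-(1/2) * ((h a - h b) ⬝ᵥ (A a b)⁻¹.mulVec (h a - h b)))) * c b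
      = ∫ v : Fin d → ℝ, ∑ a, ∑ b, c a * (Real.exp (-(1/2) * (v ⬝ᵥ (A a b).mulVec v)) *
        Real.cos (v ⬝ᵥ (h a - h b))) * c b := by
    have hI : ∀ a b, Integrable fun v : Fin d → ℝ =>
        c a * (Real.exp (-(1/2) * (v ⬝ᵥ (A a b).mulVec v)) *
          Real.cos (v ⬝ᵥ (h a - h b))) * c b :=
      fun a b => ((hF a b).1.const_mul _).mul_const _
    rw [integral_finsetSum _ fun a _ => integrable_finsetSum _ fun b _ => hI a b,
      Finset.mul_sum]
    refine Finset.sum_congr rfl fun a _ => ?_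
    rw [integral_finsetSum _ fun b _ => hI a b, Finset.mul_sum]
    refine Finset.sum_congr rfl fun b _ => ?_
    rw [integral_mul_const, integral_const_mul, (hF a b).2]
    ring
  rw [hint]
  refine integral_nonneg fun v => ?_
  have hE := (Matrix.posSemidef_iff_sum_nonneg.1 (Matrix.posSemidef_map_exp_neg
    (g := Matrix.of fun a b => ∑ ℓ, (1/2) * (v ⬝ᵥ (S ℓ).mulVec v) * g ℓ a b)
    (fun a b => by simp only [Matrix.of_apply, hsymm _ a b]) fun c hc => by
      have e : ∑ a, ∑ b, c a * (∑ ℓ, (1/2) * (v ⬝ᵥ (S ℓ).mulVec v) * g ℓ a b) * c b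
          = ∑ ℓ, (1/2) * (v ⬝ᵥ (S ℓ).mulVec v) * ∑ a, ∑ b, c a * g ℓ a b * c b := by
        simp only [Finset.mul_sum, Finset.sum_mul]
        rw [Finset.sum_comm_cycle]
        refine Finset.sum_congr rfl fun ℓ _ => Finset.sum_congr rfl fun a _ =>
          Finset.sum_congr rfl fun b _ => ?_
        ring
      simp only [Matrix.of_apply, e]
      refine Finset.sum_nonpos fun ℓ _ => mul_nonpos_of_nonneg_of_nonpos ?_ (hg ℓ c hc)
      have := (hS ℓ).dotProduct_mulVec_nonneg v
      simp only [star_trivial] at this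
      positivity)).2
  have hcos := hE fun a => c a * Real.cos (v ⬝ᵥ h a)
  have hsin := hE fun a => c a * Real.sin (v ⬝ᵥ h a)
  have e : ∑ a, ∑ b, c a * (Real.exp (-(1/2) * (v ⬝ᵥ (A a b).mulVec v)) *
        Real.cos (v ⬝ᵥ (h a - h b))) * c b
      = Real.exp (-(1/2) * (v ⬝ᵥ S0.mulVec v)) *
        (∑ a, ∑ b, c a * Real.cos (v ⬝ᵥ h a) *
          Real.exp (-∑ ℓ, (1/2) * (v ⬝ᵥ (S ℓ).mulVec v) * g ℓ a b) *
            (c b * Real.cos (v ⬝ᵥ h b)) +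
        ∑ a, ∑ b, c a * Real.sin (v ⬝ᵥ h a) *
          Real.exp (-∑ ℓ, (1/2) * (v ⬝ᵥ (S ℓ).mulVec v) * g ℓ a b) *
            (c b * Real.sin (v ⬝ᵥ h b))) := by
    simp only [← Finset.sum_add_distrib, Finset.mul_sum]
    refine Finset.sum_congr rfl fun a _ => Finset.sum_congr rfl fun b _ => ?_
    have hexp : Real.exp (-(1/2) * (v ⬝ᵥ (A a b).mulVec v))
        = Real.exp (-(1/2) * (v ⬝ᵥ S0.mulVec v)) *
          Real.exp (-∑ ℓ, (1/2) * (v ⬝ᵥ (S ℓ).mulVec v) * g ℓ a b) := by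
      rw [← Real.exp_add, hA, add_mulVec, dotProduct_add, sum_mulVec, dotProduct_sum]
      simp only [smul_mulVec, dotProduct_smul, smul_eq_mul, mul_add, Finset.mul_sum,
        ← Finset.sum_neg_distrib]
      congr 2
      exact Finset.sum_congr rfl fun ℓ _ => by ring
    rw [hexp, dotProduct_sub, Real.cos_sub]
    ring
  simp only [Pi.zero_apply, e]
  simp only [Matrix.map_apply, Matrix.of_apply] at hcos hsin
  positivity

theorem sum_dotProduct_mulVec_eq_sum_prod {N m : ℕ} (a : Fin N → Fin m → ℝ)
    (M : Fin N → Fin N → Matrix (Fin m) (Fin m) ℝ) :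
    ∑ p, ∑ q, a p ⬝ᵥ (M p q).mulVec (a q)
      = ∑ s : Fin N × Fin m, ∑ t : Fin N × Fin m,
        a s.1 s.2 * M s.1 t.1 s.2 t.2 * a t.1 t.2 := by
  simp only [Fintype.sum_prod_type, dotProduct, mulVec, Finset.mul_sum, mul_assoc]
  exact Finset.sum_congr rfl fun p _ => Finset.sum_comm

/-- Extended Gaussian model. For pseudo cross-variograms `γ^1,…,γ^n` with
nonnegative entries, a symmetric positive definite matrix `Σ` and symmetric positive
semi-definite matrices `Σ_1,…,Σ_n`, with `A_ij(u) = Σ + ∑_ℓ γ^ℓ_ij(u) Σ_ℓ`, the function with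
entries `C_ij(h,u) = det(A_ij(u))^{−1/2} exp(−(1/2) hᵀ A_ij(u)⁻¹ h)` is a positive definite
matrix-valued function on `ℝ^d × ℝ^k`. -/
theorem gaussian_extended_posdef {d k m n : ℕ}
    (γ : Fin n → (Fin k → ℝ) → Matrix (Fin m) (Fin m) ℝ)
    (hγ : ∀ ℓ, IsPseudoCrossVariogram (γ ℓ))
    (hnn : ∀ ℓ u i j, 0 ≤ γ ℓ u i j)
    (S0 : Matrix (Fin d) (Fin d) ℝ) (hS0 : S0.PosDef)
    (S : Fin n → Matrix (Fin d) (Fin d) ℝ) (hS : ∀ ℓ, (S ℓ).PosSemidef)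
    (A : Fin m → Fin m → (Fin k → ℝ) → Matrix (Fin d) (Fin d) ℝ)
    (hA : ∀ i j u, A i j u = S0 + ∑ ℓ, γ ℓ u i j • S ℓ) :
    IsPosDefFun (fun hu : (Fin d → ℝ) × (Fin k → ℝ) => Matrix.of fun i j =>
      (A i j hu.2).det ^ (-(1:ℝ)/2) *
        Real.exp (-(1/2) * (hu.1 ⬝ᵥ (A i j hu.2)⁻¹.mulVec hu.1))) := by
  simp only [IsPosDefFun, IsPosDefKernel, Matrix.of_apply]
  refine ⟨fun x y i j => ?_, fun N x a => ?_⟩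
  · have hAs : A i j (x - y).2 = A j i (y - x).2 := by
      rw [hA, hA]
      congr 1
      exact Finset.sum_congr rfl fun ℓ _ => congrArg (· • S ℓ) ((hγ ℓ).1.1 x.2 y.2 i j)
    have hh : (x - y).1 = -(y - x).1 := (neg_sub y.1 x.1).symm
    rw [hAs, hh, mulVec_neg, neg_dotProduct_neg]
  · rw [sum_dotProduct_mulVec_eq_sum_prod]
    refine sum_gaussian_mixture_nonneg
      (g := fun ℓ => Matrix.of fun s t : Fin N × Fin m => γ ℓ ((x s.1).2 - (x t.1).2) s.2 t.2)
      (A := fun s t => A s.2 t.2 ((x s.1).2 - (x t.1).2))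
      (fun ℓ s t => (hγ ℓ).1.1 _ _ _ _) (fun ℓ c hc => ?_) (fun ℓ s t => hnn ℓ _ _ _) hS0 hS
      (fun s t => hA _ _ _) (fun s => (x s.1).1) (fun s => a s.1 s.2)
    have h := (hγ ℓ).1.2 N (fun p => (x p).2) (fun p i => c (p, i))
      (by simpa [Fintype.sum_prod_type] using hc)
    rwa [sum_dotProduct_mulVec_eq_sum_prod] at h
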